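/- arXiv:2410.17904 — 2 statements merged into one kernel-verified Lean document; each statement's English description precedes it below -/
import Mathlib

section
/- Let M*_lat be a base MDP over finite latent state space S and finite action space A with horizon H and reward distributions supported on a finite set R ⊆ [0,1], let ψ* be a decodable emission process with decoder φ*, and let M*_obs = ⟨M*_lat, ψ*⟩. Then for every map φ = {φ_h : X → S}, every base model M_lat over S with rewards supported in R, every latent policy π_lat, and every h ∈ [H−1]: (i) Ẽ^{π_lat}_φ[ D²_H( M_lat,h(·,·|s_h,a_h), M̃*_φ,h(·,·|s_{1:h},a_{1:h}) ) ] ≤ E^{M*_obs, π_lat∘φ}[ Δ_h(M_lat,φ)(x_h,a_h) ], and (ii) Ẽ^{π_lat}_φ[ D²_H( M_lat,h(·,·|s_h,a_h), M̃^{*,π_lat}_φ,h(·,·|s_h,a_h) ) ] ≤ E^{M*_obs, π_lat∘φ}[ Δ_h(M_lat,φ)(x_h,a_h) ]. -/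
open Finset

attribute [local instance] Classical.propDecidable

/-- Occupancy measure of a finite-horizon MDP (layers 0-indexed). -/
noncomputable def docc {Z A : Type*} [Fintype Z] [Fintype A]
    (P0 : Z → ℝ) (P : ℕ → Z → A → Z → ℝ) (pol : ℕ → Z → A → ℝ) : ℕ → Z → ℝ
  | 0 => P0
  | h + 1 => fun z' => ∑ z, ∑ a, docc P0 P pol h z * pol h z a * P h z a z'

/-- Initial distribution of the latent-dynamics MDP `⟨M_lat, ψ⟩`; `ψ h s x = ψ_h(x|s)`. -/
noncomputable def obsInit {S X : Type*} (P0lat : S → ℝ) (ψ : ℕ → S → X → ℝ)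
    (φstar : ℕ → X → S) : X → ℝ :=
  fun x => P0lat (φstar 0 x) * ψ 0 (φstar 0 x) x

/-- Transition kernel of the latent-dynamics MDP `⟨M_lat, ψ⟩`. -/
noncomputable def obsTrans {S X A : Type*} (Plat : ℕ → S → A → S → ℝ)
    (ψ : ℕ → S → X → ℝ) (φstar : ℕ → X → S) : ℕ → X → A → X → ℝ :=
  fun h x a x' => Plat h (φstar h x) a (φstar (h + 1) x') * ψ (h + 1) (φstar (h + 1) x') x'

/-- Composition `π_lat ∘ φ`: `(π_lat∘φ)_h(a|x) = π_lat,h(a|φ_h(x))`. -/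
def compPol {S X A : Type*} (pol : ℕ → S → A → ℝ) (φ : ℕ → X → S) : ℕ → X → A → ℝ :=
  fun h x a => pol h (φ h x) a

/-- Self-prediction error `Δ_h(M_lat, φ)(x,a)` (squared Hellinger distance between the
one-step joint model of `M_lat` at `(φ_h(x),a)` and the pushforward model
`[φ_{h+1}♯M*_obs,h](·,·|x,a)`, where `M*_obs,h(r,x'|x,a) = R*(r|φ*_h(x),a)·P*_obs,h(x'|x,a)`). -/
noncomputable def selfPredErr {S X A Rwd : Type*}
    [Fintype S] [Fintype X] [Fintype Rwd]
    (R : ℕ → S → A → Rwd → ℝ) (P : ℕ → S → A → S → ℝ)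
    (RlatStar : ℕ → S → A → Rwd → ℝ) (PlatStar : ℕ → S → A → S → ℝ)
    (ψ : ℕ → S → X → ℝ) (φstar : ℕ → X → S) (φ : ℕ → X → S)
    (h : ℕ) (x : X) (a : A) : ℝ :=
  ∑ r : Rwd, ∑ s' : S,
    (Real.sqrt (R h (φ h x) a r * P h (φ h x) a s')
      - Real.sqrt (∑ x' ∈ Finset.univ.filter (fun x' => φ (h + 1) x' = s'),
          RlatStar h (φstar h x) a r * obsTrans PlatStar ψ φstar h x a x')) ^ 2

/-- Probability, under the `φ`-compressed process generated by the observation-level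
dynamics `(P0obs, Pobs)` and latent policy `π_lat` (i.e. `x_1 ∼ P0obs`, `s_i = φ_i(x_i)`,
`a_i ∼ π_lat,i(·|s_i)`, `x_{i+1} ∼ Pobs,i(·|x_i,a_i)`), of observing the prefix
`(s_0,a_0,…,s_h,a_h)` (0-indexed layers). -/
noncomputable def cprefix {S X A : Type*} [Fintype X]
    (P0obs : X → ℝ) (Pobs : ℕ → X → A → X → ℝ)
    (πlat : ℕ → S → A → ℝ) (φ : ℕ → X → S)
    (h : ℕ) (ss : Fin (h + 1) → S) (aa : Fin (h + 1) → A) : ℝ :=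
  ∑ xs : Fin (h + 1) → X,
    if ∀ i : Fin (h + 1), φ i.val (xs i) = ss i then
      P0obs (xs 0)
        * (∏ i : Fin (h + 1), πlat i.val (ss i) (aa i))
        * ∏ i : Fin h, Pobs i.val (xs i.castSucc) (aa i.castSucc) (xs i.succ)
    else 0

/-- Probability, under the same `φ`-compressed process, of observing the prefix
`(s_0,a_0,…,s_h,a_h)` together with the reward `r_h = r` and next compressed state
`s_{h+1} = s'`, where `(r_h, x_{h+1}) ∼ Robs,h(·|x_h,a_h) ⊗ Pobs,h(·|x_h,a_h)` and
`s_{h+1} = φ_{h+1}(x_{h+1})`. -/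
noncomputable def cjoint {S X A Rwd : Type*} [Fintype X]
    (P0obs : X → ℝ) (Pobs : ℕ → X → A → X → ℝ) (Robs : ℕ → X → A → Rwd → ℝ)
    (πlat : ℕ → S → A → ℝ) (φ : ℕ → X → S)
    (h : ℕ) (ss : Fin (h + 1) → S) (aa : Fin (h + 1) → A) (r : Rwd) (s' : S) : ℝ :=
  ∑ xs : Fin (h + 1) → X,
    if ∀ i : Fin (h + 1), φ i.val (xs i) = ss i then
      P0obs (xs 0)
        * (∏ i : Fin (h + 1), πlat i.val (ss i) (aa i))
        * (∏ i : Fin h, Pobs i.val (xs i.castSucc) (aa i.castSucc) (xs i.succ))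
        * ∑ x' ∈ Finset.univ.filter (fun x' => φ (h + 1) x' = s'),
            Robs h (xs (Fin.last h)) (aa (Fin.last h)) r
              * Pobs h (xs (Fin.last h)) (aa (Fin.last h)) x'
    else 0

/-- Joint concavity of `√p · √q` in the mixture: the squared Hellinger term against a weighted
average is at most the weighted average of the squared Hellinger terms. -/
theorem sum_mul_sq_sqrt_sub_sqrt_average_le {ι : Type*} (t : Finset ι) (w q : ι → ℝ) (p : ℝ)
    (hw : ∀ i ∈ t, 0 ≤ w i) (hq : ∀ i ∈ t, 0 ≤ q i) (hp : 0 ≤ p) :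
    (∑ i ∈ t, w i) * (√p - √((∑ i ∈ t, w i * q i) / ∑ i ∈ t, w i)) ^ 2
      ≤ ∑ i ∈ t, w i * (√p - √(q i)) ^ 2 := by
  have hW : 0 ≤ ∑ i ∈ t, w i := sum_nonneg hw
  have hQ : 0 ≤ ∑ i ∈ t, w i * q i := sum_nonneg fun i hi => mul_nonneg (hw i hi) (hq i hi)
  have hexpand : ∑ i ∈ t, w i * (√p - √(q i)) ^ 2
      = (∑ i ∈ t, w i) * p + ∑ i ∈ t, w i * q i - 2 * √p * ∑ i ∈ t, w i * √(q i) := by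
    rw [sum_mul, mul_sum, ← sum_add_distrib, ← sum_sub_distrib]
    refine sum_congr rfl fun i hi => ?_
    linear_combination w i * Real.sq_sqrt hp + w i * Real.sq_sqrt (hq i hi)
  rcases hW.eq_or_lt with h0 | hpos
  · rw [← h0, zero_mul]
    exact sum_nonneg fun i hi => mul_nonneg (hw i hi) (sq_nonneg _)
  have hcs : (∑ i ∈ t, w i * √(q i)) ^ 2 ≤ (∑ i ∈ t, w i) * ∑ i ∈ t, w i * q i :=
    sum_sq_le_sum_mul_sum_of_sq_le_mul t hw (fun i hi => mul_nonneg (hw i hi) (hq i hi))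
      fun i hi => by rw [mul_pow, Real.sq_sqrt (hq i hi)]; exact le_of_eq (by ring)
  set W := ∑ i ∈ t, w i
  set Q := ∑ i ∈ t, w i * q i
  have hmean : ∑ i ∈ t, w i * √(q i) ≤ W * √(Q / W) := by
    refine le_of_sq_le_sq ?_ (by positivity)
    rw [mul_pow, Real.sq_sqrt (div_nonneg hQ hW)]
    calc _ ≤ W * Q := hcs
      _ = W ^ 2 * (Q / W) := by field_simp
  have hlhs : W * (√p - √(Q / W)) ^ 2 = W * p + Q - 2 * √p * (W * √(Q / W)) := by
    have hsq := Real.sq_sqrt (div_nonneg hQ hW)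
    have hWQ : W * (Q / W) = Q := by field_simp
    linear_combination W * Real.sq_sqrt hp + W * hsq + hWQ
  rw [hexpand, hlhs]
  have := mul_le_mul_of_nonneg_left hmean (by positivity : 0 ≤ 2 * √p)
  linarith

/-- Conditioning on a statistic `g` can only decrease the expected squared Hellinger distance to
a model that depends on `g` alone. -/
theorem sum_fiber_hellinger_le {ι κ Ω : Type*} [Fintype ι] [Fintype κ] [DecidableEq κ]
    [Fintype Ω]
    (g : ι → κ) (w : ι → ℝ) (q : ι → Ω → ℝ) (p : κ → Ω → ℝ)
    (hw : ∀ i, 0 ≤ w i) (hq : ∀ i o, 0 ≤ q i o) (hp : ∀ k o, 0 ≤ p k o) :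
    ∑ k, (∑ i, if g i = k then w i else 0) * ∑ o,
        (√(p k o) - √((∑ i, if g i = k then w i * q i o else 0)
          / ∑ i, if g i = k then w i else 0)) ^ 2
      ≤ ∑ i, w i * ∑ o, (√(p (g i) o) - √(q i o)) ^ 2 := by
  rw [← sum_fiberwise univ g]
  refine sum_le_sum fun k _ => ?_
  simp only [← sum_filter, mul_sum]
  rw [sum_comm (s := univ.filter fun i => g i = k)]
  refine sum_le_sum fun o _ => ?_
  refine (sum_mul_sq_sqrt_sub_sqrt_average_le _ w (fun i => q i o) (p k o) (fun i _ => hw i)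
    (fun i _ => hq i o) (hp k o)).trans_eq (sum_congr rfl fun i hi => ?_)
  rw [(mem_filter.1 hi).2]

theorem sum_ite_sum_fiber {ι κ : Type*} [Fintype ι] [Fintype κ] [DecidableEq κ] (g : ι → κ)
    (c : κ → Prop) [DecidablePred c] (w : ι → ℝ) :
    (∑ k, if c k then ∑ i, (if g i = k then w i else 0) else 0)
      = ∑ i, if c (g i) then w i else 0 := by
  have hpush : ∀ k, (if c k then ∑ i, (if g i = k then w i else 0) else 0)
      = ∑ i, if g i = k then (if c k then w i else 0) else 0 := fun k => by
    split_ifs <;> simp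
  simp_rw [hpush]
  rw [sum_comm]
  simp

/-- Probability of the observation-action trajectory `(xs, aa)` up to layer `h`. -/
noncomputable def trajProb {X A : Type*} (P0 : X → ℝ) (P : ℕ → X → A → X → ℝ)
    (pol : ℕ → X → A → ℝ) (h : ℕ) (xs : Fin (h + 1) → X) (aa : Fin (h + 1) → A) : ℝ :=
  P0 (xs 0) * (∏ i : Fin (h + 1), pol i.val (xs i) (aa i))
    * ∏ i : Fin h, P i.val (xs i.castSucc) (aa i.castSucc) (xs i.succ)

theorem trajProb_nonneg {X A : Type*} {P0 : X → ℝ} {P : ℕ → X → A → X → ℝ}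
    {pol : ℕ → X → A → ℝ} {h : ℕ} (h0 : ∀ x, 0 ≤ P0 x)
    (hP : ∀ i < h, ∀ x a x', 0 ≤ P i x a x') (hpol : ∀ i ≤ h, ∀ x a, 0 ≤ pol i x a)
    (xs : Fin (h + 1) → X) (aa : Fin (h + 1) → A) : 0 ≤ trajProb P0 P pol h xs aa :=
  mul_nonneg (mul_nonneg (h0 _) (prod_nonneg fun i _ => hpol _ (Nat.lt_succ_iff.1 i.2) _ _))
    (prod_nonneg fun i _ => hP _ i.2 _ _ _)

theorem trajProb_snoc {X A : Type*} (P0 : X → ℝ) (P : ℕ → X → A → X → ℝ)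
    (pol : ℕ → X → A → ℝ) (h : ℕ) (xs : Fin (h + 1) → X) (aa : Fin (h + 1) → A) (x : X) (a : A) :
    trajProb P0 P pol (h + 1) (Fin.snoc xs x : Fin (h + 2) → X) (Fin.snoc aa a : Fin (h + 2) → A)
      = trajProb P0 P pol h xs aa * P h (xs (Fin.last h)) (aa (Fin.last h)) x
          * pol (h + 1) x a := by
  have hzero : (Fin.snoc xs x : Fin (h + 2) → X) 0 = xs 0 :=
    Fin.snoc_castSucc (α := fun _ => X) x xs 0
  unfold trajProb
  rw [Fin.prod_univ_castSucc (n := h + 1), hzero,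
    Fin.prod_univ_castSucc (n := h) (f := fun i => P i.val _ _ _)]
  simp only [Fin.succ_castSucc, Fin.succ_last, Fin.snoc_castSucc, Fin.snoc_last,
    Fin.val_castSucc, Fin.val_last]
  ring

theorem sum_snoc {X : Type*} [Fintype X] (n : ℕ) (F : (Fin (n + 1) → X) → ℝ) :
    ∑ xs, F xs = ∑ xs : Fin n → X, ∑ x, F (Fin.snoc xs x : Fin (n + 1) → X) := by
  rw [← (Fin.snocEquiv fun _ : Fin (n + 1) => X).sum_comp, Fintype.sum_prod_type, sum_comm]
  rfl

/-- The occupancy measure is the marginal of the trajectory law. -/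
theorem sum_docc_mul_eq_sum_trajProb {X A : Type*} [Fintype X] [Fintype A]
    (P0 : X → ℝ) (P : ℕ → X → A → X → ℝ) (pol : ℕ → X → A → ℝ) (h : ℕ) (f : X → A → ℝ) :
    ∑ x, ∑ a, docc P0 P pol h x * pol h x a * f x a
      = ∑ xs : Fin (h + 1) → X, ∑ aa : Fin (h + 1) → A,
          trajProb P0 P pol h xs aa * f (xs (Fin.last h)) (aa (Fin.last h)) := by
  induction h generalizing f with
  | zero =>
    rw [← (Equiv.funUnique (Fin 1) X).symm.sum_comp]
    refine sum_congr rfl fun x _ => ?_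
    rw [← (Equiv.funUnique (Fin 1) A).symm.sum_comp]
    simp [trajProb, docc]
  | succ h ih =>
    have hstep := ih fun x a => ∑ x', ∑ a', P h x a x' * (pol (h + 1) x' a' * f x' a')
    calc ∑ x', ∑ a', docc P0 P pol (h + 1) x' * pol (h + 1) x' a' * f x' a'
        = ∑ x', ∑ a', ∑ x, ∑ a, docc P0 P pol h x * pol h x a
            * (P h x a x' * (pol (h + 1) x' a' * f x' a')) := by
          simp only [docc, sum_mul, mul_assoc]
      _ = ∑ x, ∑ a, docc P0 P pol h x * pol h x a
            * ∑ x', ∑ a', P h x a x' * (pol (h + 1) x' a' * f x' a') := by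
          simp only [mul_sum]
          simpa only [Fintype.sum_prod_type] using sum_comm (s := (univ : Finset (X × A)))
            (t := (univ : Finset (X × A))) (f := fun p' p => docc P0 P pol h p.1 * pol h p.1 p.2
              * (P h p.1 p.2 p'.1 * (pol (h + 1) p'.1 p'.2 * f p'.1 p'.2)))
      _ = _ := hstep
      _ = _ := by
          rw [sum_snoc (h + 1)]
          refine sum_congr rfl fun xs _ => ?_
          simp only [sum_snoc (X := A) (h + 1), trajProb_snoc, Fin.snoc_last]
          rw [sum_comm]
          refine sum_congr rfl fun aa _ => ?_
          simp only [mul_sum, mul_assoc]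

section Compressed

variable {S X A Rwd : Type*} [Fintype X] [Fintype A]
  (P0 : X → ℝ) (P : ℕ → X → A → X → ℝ) (R : ℕ → X → A → Rwd → ℝ)
  (pol : ℕ → S → A → ℝ) (φ : ℕ → X → S) (h : ℕ)

/-- The compressed prefix generated by an observation-action trajectory. -/
def compressTraj (t : (Fin (h + 1) → X) × (Fin (h + 1) → A)) :
    (Fin (h + 1) → S) × (Fin (h + 1) → A) :=
  (fun i => φ i.val (t.1 i), t.2)

/-- Law of the reward and the next compressed state given the observation and action. -/
noncomputable def pushModel (x : X) (a : A) (o : Rwd × S) : ℝ :=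
  ∑ x' ∈ univ.filter (fun x' => φ (h + 1) x' = o.2), R h x a o.1 * P h x a x'

theorem cprefix_eq_sum_trajProb (k : (Fin (h + 1) → S) × (Fin (h + 1) → A)) :
    cprefix P0 P pol φ h k.1 k.2
      = ∑ t, if compressTraj φ h t = k then
          trajProb P0 P (compPol pol φ) h t.1 t.2 else 0 := by
  obtain ⟨ss, aa⟩ := k
  rw [Fintype.sum_prod_type]
  refine sum_congr rfl fun xs _ => ?_
  simp only [compressTraj, Prod.mk.injEq, funext_iff (f := fun i => φ _ _), ite_and]
  split_ifs with hs
  · simp [trajProb, compPol, hs]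
  · simp

theorem cjoint_eq_sum_trajProb (k : (Fin (h + 1) → S) × (Fin (h + 1) → A)) (r : Rwd) (s' : S) :
    cjoint P0 P R pol φ h k.1 k.2 r s'
      = ∑ t, if compressTraj φ h t = k then
          trajProb P0 P (compPol pol φ) h t.1 t.2
            * pushModel P R φ h (t.1 (Fin.last h)) (t.2 (Fin.last h)) (r, s') else 0 := by
  obtain ⟨ss, aa⟩ := k
  rw [Fintype.sum_prod_type]
  refine sum_congr rfl fun xs _ => ?_
  simp only [compressTraj, Prod.mk.injEq, funext_iff (f := fun i => φ _ _), ite_and]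
  split_ifs with hs
  · simp [trajProb, compPol, pushModel, hs]
  · simp

variable [Fintype S] [Fintype Rwd]

/-- Near-Markovianity of a compressed process, for any statistic `g` of the prefix. -/
theorem compressed_hellinger_le {κ : Type*} [Fintype κ] [DecidableEq κ]
    (g : (Fin (h + 1) → S) × (Fin (h + 1) → A) → κ) (p : κ → Rwd × S → ℝ)
    (m : S → A → Rwd × S → ℝ)
    (hg : ∀ k, p (g k) = m (k.1 (Fin.last h)) (k.2 (Fin.last h)))
    (h0 : ∀ x, 0 ≤ P0 x) (hP : ∀ i ≤ h, ∀ x a x', 0 ≤ P i x a x')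
    (hR : ∀ x a r, 0 ≤ R h x a r) (hpol : ∀ i ≤ h, ∀ s a, 0 ≤ pol i s a)
    (hp : ∀ k o, 0 ≤ p k o) :
    ∑ k, (∑ j, if g j = k then cprefix P0 P pol φ h j.1 j.2 else 0) * ∑ o : Rwd × S,
        (√(p k o) - √((∑ j, if g j = k then cjoint P0 P R pol φ h j.1 j.2 o.1 o.2 else 0)
          / ∑ j, if g j = k then cprefix P0 P pol φ h j.1 j.2 else 0)) ^ 2
      ≤ ∑ x, ∑ a, docc P0 P (compPol pol φ) h x * compPol pol φ h x a
          * ∑ o, (√(m (φ h x) a o) - √(pushModel P R φ h x a o)) ^ 2 := by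
  simp only [cprefix_eq_sum_trajProb, cjoint_eq_sum_trajProb]
  rw [sum_docc_mul_eq_sum_trajProb, ← Fintype.sum_prod_type'
    (f := fun xs aa => trajProb P0 P (compPol pol φ) h xs aa * ∑ o,
      (√(m (φ h (xs (Fin.last h))) (aa (Fin.last h)) o)
        - √(pushModel P R φ h (xs (Fin.last h)) (aa (Fin.last h)) o)) ^ 2)]
  have hfib : ∀ k (w : (Fin (h + 1) → X) × (Fin (h + 1) → A) → ℝ),
      (∑ j, if g j = k then ∑ t, (if compressTraj φ h t = j then w t else 0) else 0)
        = ∑ t, if g (compressTraj φ h t) = k then w t else 0 :=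
    fun k w => sum_ite_sum_fiber _ (fun j => g j = k) w
  simp only [hfib]
  refine (sum_fiber_hellinger_le (fun t => g (compressTraj φ h t)) _ _ p
    (fun t => trajProb_nonneg h0 (fun i hi => hP i hi.le) (fun i hi x a => hpol i hi _ a) t.1 t.2)
    (fun t o => sum_nonneg fun x' _ => mul_nonneg (hR _ _ _) (hP h le_rfl _ _ _))
    hp).trans_eq (sum_congr rfl fun t _ => ?_)
  rw [hg]
  rfl

end Compressed

/-- Near-Markovianity of the `φ`-compressed dynamics.  For every map
`φ`, base model `M_lat = (R,P)`, latent policy `π_lat`, and `h ∈ [H−1]` (0-indexed: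
`h+1 < H`):
(i) the expected squared Hellinger distance between `M_lat,h(·,·|s_h,a_h)` and the
conditional law `M̃*_φ,h(·,·|s_{1:h},a_{1:h})` of `(r_h,s_{h+1})` given the whole prefix
under the `φ`-compressed process is at most `E^{M*_obs,π_lat∘φ}[Δ_h(M_lat,φ)(x_h,a_h)]`;
(ii) the same bound holds for the conditional law `M̃^{*,π_lat}_φ,h(·,·|s_h,a_h)` given
only `(s_h,a_h)`.  Conditional laws are expressed as ratios of the prefix probabilities
`cprefix`/`cjoint`; zero-probability conditioning events carry zero weight. -/
theorem statement15 (S X A Rwd : Type*)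
    [Fintype S] [Fintype X] [Fintype A] [Fintype Rwd]
    [Nonempty S] [Nonempty X] [Nonempty A]
    (H : ℕ) (hH : 0 < H)
    (Rval : Rwd → ℝ) (hRval : ∀ r, Rval r ∈ Set.Icc (0:ℝ) 1)
    -- the true latent model M*_lat and the emission process
    (P0latStar : S → ℝ) (h00 : ∀ s, 0 ≤ P0latStar s) (h01 : ∑ s, P0latStar s = 1)
    (PlatStar : ℕ → S → A → S → ℝ)
    (hPnnStar : ∀ h, h + 1 < H → ∀ s a s', 0 ≤ PlatStar h s a s')
    (hPsumStar : ∀ h, h + 1 < H → ∀ s a, ∑ s', PlatStar h s a s' = 1)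
    (RlatStar : ℕ → S → A → Rwd → ℝ)
    (hRnnStar : ∀ h, h < H → ∀ s a r, 0 ≤ RlatStar h s a r)
    (hRsumStar : ∀ h, h < H → ∀ s a, ∑ r, RlatStar h s a r = 1)
    (ψ : ℕ → S → X → ℝ)
    (hψnn : ∀ h, h < H → ∀ s x, 0 ≤ ψ h s x)
    (hψsum : ∀ h, h < H → ∀ s, ∑ x, ψ h s x = 1)
    (hdec : ∀ h, h < H → ∀ s s' x, s ≠ s' → ψ h s x ≠ 0 → ψ h s' x = 0)
    (φstar : ℕ → X → S)
    (hφstar : ∀ h, h < H → ∀ s x, ψ h s x ≠ 0 → φstar h x = s)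
    -- an arbitrary base model M_lat = (R, P) over S
    (Rlat : ℕ → S → A → Rwd → ℝ)
    (hRnn : ∀ h, h < H → ∀ s a r, 0 ≤ Rlat h s a r)
    (hRsum : ∀ h, h < H → ∀ s a, ∑ r, Rlat h s a r = 1)
    (Plat : ℕ → S → A → S → ℝ)
    (hPnn : ∀ h, h + 1 < H → ∀ s a s', 0 ≤ Plat h s a s')
    (hPsum : ∀ h, h + 1 < H → ∀ s a, ∑ s', Plat h s a s' = 1)
    -- latent policy and map
    (πlat : ℕ → S → A → ℝ)
    (hπ : ∀ h, h < H → ∀ s, (∀ a, 0 ≤ πlat h s a) ∧ ∑ a, πlat h s a = 1)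
    (φ : ℕ → X → S)
    (h : ℕ) (hh : h + 1 < H) :
    -- (i): conditioning on the whole prefix (s_{1:h}, a_{1:h})
    ((∑ ss : Fin (h + 1) → S, ∑ aa : Fin (h + 1) → A,
        cprefix (obsInit P0latStar ψ φstar) (obsTrans PlatStar ψ φstar) πlat φ h ss aa *
          ∑ r : Rwd, ∑ s' : S,
            (Real.sqrt (Rlat h (ss (Fin.last h)) (aa (Fin.last h)) r
                  * Plat h (ss (Fin.last h)) (aa (Fin.last h)) s')
              - Real.sqrt
                  (cjoint (obsInit P0latStar ψ φstar) (obsTrans PlatStar ψ φstar)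
                      (fun k x a r => RlatStar k (φstar k x) a r) πlat φ h ss aa r s'
                    / cprefix (obsInit P0latStar ψ φstar) (obsTrans PlatStar ψ φstar)
                        πlat φ h ss aa)) ^ 2)
      ≤ ∑ x, ∑ a,
          docc (obsInit P0latStar ψ φstar) (obsTrans PlatStar ψ φstar) (compPol πlat φ) h x
            * compPol πlat φ h x a
            * selfPredErr Rlat Plat RlatStar PlatStar ψ φstar φ h x a)
    ∧
    -- (ii): conditioning on (s_h, a_h) only
    ((∑ s : S, ∑ a : A,
        (∑ ss : Fin (h + 1) → S, ∑ aa : Fin (h + 1) → A,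
          if ss (Fin.last h) = s ∧ aa (Fin.last h) = a then
            cprefix (obsInit P0latStar ψ φstar) (obsTrans PlatStar ψ φstar) πlat φ h ss aa
          else 0) *
          ∑ r : Rwd, ∑ s' : S,
            (Real.sqrt (Rlat h s a r * Plat h s a s')
              - Real.sqrt
                  ((∑ ss : Fin (h + 1) → S, ∑ aa : Fin (h + 1) → A,
                    if ss (Fin.last h) = s ∧ aa (Fin.last h) = a then
                      cjoint (obsInit P0latStar ψ φstar) (obsTrans PlatStar ψ φstar)
                        (fun k x a r => RlatStar k (φstar k x) a r) πlat φ h ss aa r s'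
                    else 0)
                  / (∑ ss : Fin (h + 1) → S, ∑ aa : Fin (h + 1) → A,
                    if ss (Fin.last h) = s ∧ aa (Fin.last h) = a then
                      cprefix (obsInit P0latStar ψ φstar) (obsTrans PlatStar ψ φstar)
                        πlat φ h ss aa
                    else 0))) ^ 2)
      ≤ ∑ x, ∑ a,
          docc (obsInit P0latStar ψ φstar) (obsTrans PlatStar ψ φstar) (compPol πlat φ) h x
            * compPol πlat φ h x a
            * selfPredErr Rlat Plat RlatStar PlatStar ψ φstar φ h x a) := by
  have h0 : ∀ x, 0 ≤ obsInit P0latStar ψ φstar x := fun x =>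
    mul_nonneg (h00 _) (hψnn 0 hH _ _)
  have hP : ∀ i ≤ h, ∀ x a x', 0 ≤ obsTrans PlatStar ψ φstar i x a x' := fun i hi x a x' =>
    mul_nonneg (hPnnStar i (by omega) _ _ _) (hψnn (i + 1) (by omega) _ _)
  have hR : ∀ x a r, 0 ≤ RlatStar h (φstar h x) a r := fun x a r => hRnnStar h (by omega) _ a r
  have hpol : ∀ i ≤ h, ∀ s a, 0 ≤ πlat i s a := fun i hi s a => (hπ i (by omega) s).1 a
  have hm : ∀ s a (o : Rwd × S), 0 ≤ Rlat h s a o.1 * Plat h s a o.2 := fun s a o =>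
    mul_nonneg (hRnn h (by omega) s a o.1) (hPnn h hh s a o.2)
  constructor
  · have key := compressed_hellinger_le (obsInit P0latStar ψ φstar) (obsTrans PlatStar ψ φstar)
      (fun k x a r => RlatStar k (φstar k x) a r) πlat φ h id
      (fun k o => Rlat h (k.1 (Fin.last h)) (k.2 (Fin.last h)) o.1
        * Plat h (k.1 (Fin.last h)) (k.2 (Fin.last h)) o.2)
      (fun s a o => Rlat h s a o.1 * Plat h s a o.2) (fun _ => rfl) h0 hP hR hpol
      (fun k o => hm _ _ o)
    have hfib : ∀ k (F : (Fin (h + 1) → S) × (Fin (h + 1) → A) → ℝ),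
        (∑ j, if id j = k then F j else 0) = F k := by simp
    simp only [hfib] at key
    simpa only [Fintype.sum_prod_type, selfPredErr, pushModel] using key
  · have key := compressed_hellinger_le (obsInit P0latStar ψ φstar) (obsTrans PlatStar ψ φstar)
      (fun k x a r => RlatStar k (φstar k x) a r) πlat φ h
      (fun k => (k.1 (Fin.last h), k.2 (Fin.last h)))
      (fun k o => Rlat h k.1 k.2 o.1 * Plat h k.1 k.2 o.2)
      (fun s a o => Rlat h s a o.1 * Plat h s a o.2) (fun _ => rfl) h0 hP hR hpol
      (fun k o => hm _ _ o)
    simpa only [Prod.mk.injEq, Fintype.sum_prod_type, selfPredErr, pushModel] using key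
end

section
/- Let M*_lat be a base MDP over finite latent state space S and finite action space A with horizon H and reward distributions supported on a finite set R ⊆ [0,1], let ψ* be a decodable emission process with decoder φ*, and let M*_obs = ⟨M*_lat, ψ*⟩. Let M_lat be any base MDP over S with rewards supported in R, let φ = {φ_h : X → S} be a map, π_lat a latent policy, and let f = (f_1,…,f_{H+1}) with f_h : S × A → [0,1] satisfy the Bellman-consistency f_h = T^{M_lat,π_lat}_h f_{h+1} for all h ∈ [H] (with f_{H+1} ≡ 0). Then for every h ∈ [H]: E^{M*_obs, π_lat∘φ}[ ( f_h(φ_h(x_h),a_h) − [T^{M*_obs, π_lat∘φ}_h (f_{h+1}∘φ_{h+1})](x_h,a_h) )² ] ≤ 4·E^{M*_obs, π_lat∘φ}[ D²_H( M_lat,h(·,·|φ_h(x_h),a_h), [φ_{h+1}♯M*_obs,h](·,·|x_h,a_h) ) ], where (f_{h+1}∘φ_{h+1})(x',a') = f_{h+1}(φ_{h+1}(x'),a'). -/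
open Finset

attribute [local instance] Classical.propDecidable

/-- For probability vectors `p`, `q` and `g` with values in `[0, 2]`, the squared difference of the
means of `g` is at most four times the squared Hellinger distance of `p` and `q`. -/
theorem sq_sum_sub_mul_le_hellinger {ι : Type*} [Fintype ι] (p q g : ι → ℝ)
    (hp : ∀ i, 0 ≤ p i) (hq : ∀ i, 0 ≤ q i) (hp1 : ∑ i, p i = 1) (hq1 : ∑ i, q i = 1)
    (hg : ∀ i, g i ∈ Set.Icc (0 : ℝ) 2) :
    (∑ i, (p i - q i) * g i) ^ 2 ≤ 4 * ∑ i, (Real.sqrt (p i) - Real.sqrt (q i)) ^ 2 := by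
  have hcenter : ∑ i, (p i - q i) * g i
      = ∑ i, (Real.sqrt (p i) - Real.sqrt (q i))
          * ((Real.sqrt (p i) + Real.sqrt (q i)) * (g i - 1)) := by
    have hfactor : ∀ i, (Real.sqrt (p i) - Real.sqrt (q i))
        * ((Real.sqrt (p i) + Real.sqrt (q i)) * (g i - 1))
          = (p i - q i) * g i - (p i - q i) := fun i => by
      linear_combination (g i - 1) * Real.sq_sqrt (hp i) - (g i - 1) * Real.sq_sqrt (hq i)
    simp only [hfactor, Finset.sum_sub_distrib, hp1, hq1, sub_self, sub_zero]
  have hbound : ∑ i, ((Real.sqrt (p i) + Real.sqrt (q i)) * (g i - 1)) ^ 2 ≤ 4 := by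
    calc ∑ i, ((Real.sqrt (p i) + Real.sqrt (q i)) * (g i - 1)) ^ 2
        ≤ ∑ i, (2 * p i + 2 * q i) := by
          refine Finset.sum_le_sum fun i _ => ?_
          have hg1 : (g i - 1) ^ 2 ≤ 1 := by
            nlinarith [(hg i).1, (hg i).2]
          rw [mul_pow]
          calc (Real.sqrt (p i) + Real.sqrt (q i)) ^ 2 * (g i - 1) ^ 2
              ≤ (Real.sqrt (p i) + Real.sqrt (q i)) ^ 2 :=
                mul_le_of_le_one_right (sq_nonneg _) hg1
            _ ≤ 2 * p i + 2 * q i := by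
                nlinarith [Real.sq_sqrt (hp i), Real.sq_sqrt (hq i),
                  sq_nonneg (Real.sqrt (p i) - Real.sqrt (q i))]
      _ = 4 := by
          rw [Finset.sum_add_distrib, ← Finset.mul_sum, ← Finset.mul_sum, hp1, hq1]
          norm_num
  rw [hcenter, mul_comm (4 : ℝ)]
  exact (Finset.sum_mul_sq_le_sq_mul_sq _ _ _).trans
    (mul_le_mul_of_nonneg_left hbound (Finset.sum_nonneg fun i _ => sq_nonneg _))

theorem sum_sum_mul_mul_add {α β : Type*} [Fintype α] [Fintype β] (R u : α → ℝ) (P v : β → ℝ)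
    (hR : ∑ r, R r = 1) (hP : ∑ s, P s = 1) :
    ∑ i : α × β, R i.1 * P i.2 * (u i.1 + v i.2) = (∑ r, u r * R r) + ∑ s, P s * v s := by
  calc ∑ i : α × β, R i.1 * P i.2 * (u i.1 + v i.2)
      = ∑ r, ∑ s, (u r * R r * P s + R r * (P s * v s)) := by
        rw [Fintype.sum_prod_type]
        exact Finset.sum_congr rfl fun r _ => Finset.sum_congr rfl fun s _ => by ring
    _ = (∑ r, u r * R r) + ∑ s, P s * v s := by
        simp only [Finset.sum_add_distrib, ← Finset.mul_sum, ← Finset.sum_mul, hR, hP, mul_one,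
          one_mul]

/-- The one-step Bellman backups of two product models with rewards and values in `[0, 1]` differ
in square by at most four times the squared Hellinger distance of the joint models. -/
theorem sq_backup_sub_le_hellinger {α β : Type*} [Fintype α] [Fintype β]
    (R R' u : α → ℝ) (P P' v : β → ℝ)
    (hR : ∀ r, 0 ≤ R r) (hR1 : ∑ r, R r = 1) (hR' : ∀ r, 0 ≤ R' r) (hRsum' : ∑ r, R' r = 1)
    (hP : ∀ s, 0 ≤ P s) (hP1 : ∑ s, P s = 1) (hP' : ∀ s, 0 ≤ P' s) (hPsum' : ∑ s, P' s = 1)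
    (hu : ∀ r, u r ∈ Set.Icc (0 : ℝ) 1) (hv : ∀ s, v s ∈ Set.Icc (0 : ℝ) 1) :
    (((∑ r, u r * R r) + ∑ s, P s * v s) - ((∑ r, u r * R' r) + ∑ s, P' s * v s)) ^ 2
      ≤ 4 * ∑ r, ∑ s, (Real.sqrt (R r * P s) - Real.sqrt (R' r * P' s)) ^ 2 := by
  have hellinger := sq_sum_sub_mul_le_hellinger (fun i : α × β => R i.1 * P i.2)
    (fun i => R' i.1 * P' i.2) (fun i => u i.1 + v i.2)
    (fun i => mul_nonneg (hR _) (hP _)) (fun i => mul_nonneg (hR' _) (hP' _))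
    (by simp only [Fintype.sum_prod_type, ← Finset.mul_sum, hR1, hP1, mul_one])
    (by simp only [Fintype.sum_prod_type, ← Finset.mul_sum, hRsum', hPsum', mul_one])
    (fun i => ⟨add_nonneg (hu _).1 (hv _).1, by
      show u i.1 + v i.2 ≤ 2
      linarith [(hu i.1).2, (hv i.2).2]⟩)
  rwa [← sum_sum_mul_mul_add R u P v hR1 hP1, ← sum_sum_mul_mul_add R' u P' v hRsum' hPsum',
    ← Finset.sum_sub_distrib, ← Fintype.sum_prod_type'
      (f := fun r s => (Real.sqrt (R r * P s) - Real.sqrt (R' r * P' s)) ^ 2),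
    Finset.sum_congr rfl fun i _ => (sub_mul _ _ _).symm]

theorem docc_nonneg {Z A : Type*} [Fintype Z] [Fintype A]
    (P0 : Z → ℝ) (P : ℕ → Z → A → Z → ℝ) (pol : ℕ → Z → A → ℝ) (h : ℕ)
    (h0 : ∀ z, 0 ≤ P0 z) (hP : ∀ k, k < h → ∀ z a z', 0 ≤ P k z a z')
    (hpol : ∀ k, k < h → ∀ z a, 0 ≤ pol k z a) (z : Z) :
    0 ≤ docc P0 P pol h z := by
  induction h generalizing z with
  | zero => exact h0 z
  | succ n ih =>
    exact Finset.sum_nonneg fun y _ => Finset.sum_nonneg fun a _ =>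
      mul_nonneg (mul_nonneg
        (ih (fun k hk => hP k (hk.trans n.lt_succ_self))
          (fun k hk => hpol k (hk.trans n.lt_succ_self)) y)
        (hpol n n.lt_succ_self y a)) (hP n n.lt_succ_self y a z)

/-- Decoding an observation turns the emitted mixture back into a sum over latent states. -/
theorem sum_decoded_emission {S X : Type*} [Fintype S] [Fintype X] (p : S → ℝ) (ψ : S → X → ℝ)
    (φ : X → S) (hψ : ∀ s, ∑ x, ψ s x = 1) (hφ : ∀ s x, ψ s x ≠ 0 → φ x = s) :
    ∑ x, p (φ x) * ψ (φ x) x = ∑ s, p s := by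
  have hmix : ∀ x, p (φ x) * ψ (φ x) x = ∑ s, p s * ψ s x := fun x =>
    (Fintype.sum_eq_single (f := fun s => p s * ψ s x) (φ x) fun s hs => by
      show p s * ψ s x = 0
      rw [not_ne_iff.mp fun hne => hs (hφ s x hne).symm, mul_zero]).symm
  simp only [hmix]
  rw [Finset.sum_comm]
  simp only [← Finset.mul_sum, hψ, mul_one]

/-- If `f = (f_1,…,f_{H+1})` (0-indexed: `f 0, …, f H` with
`f H ≡ 0`) is Bellman-consistent for `(M_lat, π_lat)`, i.e.
`f_h = T^{M_lat,π_lat}_h f_{h+1}`, then for every `h ∈ [H]` (0-indexed: `h < H`)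
the expected squared Bellman residual of `f_h∘φ_h` with respect to the evaluation
operator of `M*_obs = ⟨M*_lat,ψ*⟩` under `π_lat∘φ` is at most four times the expected
self-prediction error:
`E^{M*_obs,π_lat∘φ}[(f_h(φ_h(x_h),a_h) − [T^{M*_obs,π_lat∘φ}_h (f_{h+1}∘φ_{h+1})](x_h,a_h))²]
  ≤ 4·E^{M*_obs,π_lat∘φ}[D²_H(M_lat,h(·,·|φ_h(x_h),a_h), [φ_{h+1}♯M*_obs,h](·,·|x_h,a_h))]`.
Mean rewards are the means of the reward distributions with values `Rval : Rwd → [0,1]`.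
(Validity of the data is assumed on all the indices appearing in the statement,
including the boundary layer `h = H`.) -/
theorem statement18 (S X A Rwd : Type*)
    [Fintype S] [Fintype X] [Fintype A] [Fintype Rwd]
    [Nonempty S] [Nonempty X] [Nonempty A]
    (H : ℕ) (hH : 0 < H)
    (Rval : Rwd → ℝ) (hRval : ∀ r, Rval r ∈ Set.Icc (0:ℝ) 1)
    -- the true latent model M*_lat and the emission process
    (P0latStar : S → ℝ) (h00 : ∀ s, 0 ≤ P0latStar s) (h01 : ∑ s, P0latStar s = 1)
    (PlatStar : ℕ → S → A → S → ℝ)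
    (hPnnStar : ∀ h, h < H → ∀ s a s', 0 ≤ PlatStar h s a s')
    (hPsumStar : ∀ h, h < H → ∀ s a, ∑ s', PlatStar h s a s' = 1)
    (RlatStar : ℕ → S → A → Rwd → ℝ)
    (hRnnStar : ∀ h, h < H → ∀ s a r, 0 ≤ RlatStar h s a r)
    (hRsumStar : ∀ h, h < H → ∀ s a, ∑ r, RlatStar h s a r = 1)
    (ψ : ℕ → S → X → ℝ)
    (hψnn : ∀ h, h < H + 1 → ∀ s x, 0 ≤ ψ h s x)
    (hψsum : ∀ h, h < H + 1 → ∀ s, ∑ x, ψ h s x = 1)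
    (hdec : ∀ h, h < H + 1 → ∀ s s' x, s ≠ s' → ψ h s x ≠ 0 → ψ h s' x = 0)
    (φstar : ℕ → X → S)
    (hφstar : ∀ h, h < H + 1 → ∀ s x, ψ h s x ≠ 0 → φstar h x = s)
    -- an arbitrary base model M_lat = (R, P) over S
    (Rlat : ℕ → S → A → Rwd → ℝ)
    (hRnn : ∀ h, h < H → ∀ s a r, 0 ≤ Rlat h s a r)
    (hRsum : ∀ h, h < H → ∀ s a, ∑ r, Rlat h s a r = 1)
    (Plat : ℕ → S → A → S → ℝ)
    (hPnn : ∀ h, h < H → ∀ s a s', 0 ≤ Plat h s a s')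
    (hPsum : ∀ h, h < H → ∀ s a, ∑ s', Plat h s a s' = 1)
    -- latent policy and map
    (πlat : ℕ → S → A → ℝ)
    (hπ : ∀ h, h < H + 1 → ∀ s, (∀ a, 0 ≤ πlat h s a) ∧ ∑ a, πlat h s a = 1)
    (φ : ℕ → X → S)
    -- a Bellman-consistent tuple f for (M_lat, π_lat)
    (f : ℕ → S → A → ℝ)
    (hfbd : ∀ h, h < H + 1 → ∀ s a, f h s a ∈ Set.Icc (0:ℝ) 1)
    (hfH : ∀ s a, f H s a = 0)
    (hcons : ∀ h, h < H → ∀ s a,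
        f h s a = (∑ r, Rval r * Rlat h s a r)
          + ∑ s', Plat h s a s' * ∑ a', πlat (h + 1) s' a' * f (h + 1) s' a')
    (h : ℕ) (hh : h < H) :
    (∑ x, ∑ a,
        docc (obsInit P0latStar ψ φstar) (obsTrans PlatStar ψ φstar) (compPol πlat φ) h x
          * compPol πlat φ h x a *
          (f h (φ h x) a
            - ((∑ r, Rval r * RlatStar h (φstar h x) a r)
              + ∑ x', obsTrans PlatStar ψ φstar h x a x' *
                  ∑ a', πlat (h + 1) (φ (h + 1) x') a' * f (h + 1) (φ (h + 1) x') a')) ^ 2)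
      ≤ 4 * ∑ x, ∑ a,
          docc (obsInit P0latStar ψ φstar) (obsTrans PlatStar ψ φstar) (compPol πlat φ) h x
            * compPol πlat φ h x a
            * selfPredErr Rlat Plat RlatStar PlatStar ψ φstar φ h x a := by
  have hTnn : ∀ k, k < H → ∀ x a x', 0 ≤ obsTrans PlatStar ψ φstar k x a x' :=
    fun k hk x a x' => mul_nonneg (hPnnStar k hk _ _ _) (hψnn _ (by omega) _ _)
  have hTsum : ∀ x a, ∑ x', obsTrans PlatStar ψ φstar h x a x' = 1 := fun x a =>
    (sum_decoded_emission (PlatStar h (φstar h x) a) (ψ (h + 1)) (φstar (h + 1))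
      (hψsum _ (by omega)) (hφstar _ (by omega))).trans (hPsumStar h hh _ _)
  have hV : ∀ s, (∑ a, πlat (h + 1) s a * f (h + 1) s a) ∈ Set.Icc (0 : ℝ) 1 := fun s => by
    obtain ⟨hπnn, hπsum⟩ := hπ (h + 1) (by omega) s
    have hf := hfbd (h + 1) (by omega) s
    refine ⟨Finset.sum_nonneg fun a _ => mul_nonneg (hπnn a) (hf a).1, ?_⟩
    rw [← hπsum]
    exact Finset.sum_le_sum fun a _ => mul_le_of_le_one_right (hπnn a) (hf a).2
  have hpointwise : ∀ x a,
      (f h (φ h x) a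
        - ((∑ r, Rval r * RlatStar h (φstar h x) a r)
          + ∑ x', obsTrans PlatStar ψ φstar h x a x' *
              ∑ a', πlat (h + 1) (φ (h + 1) x') a' * f (h + 1) (φ (h + 1) x') a')) ^ 2
      ≤ 4 * selfPredErr Rlat Plat RlatStar PlatStar ψ φstar φ h x a := fun x a => by
    have hpush : ∑ x', obsTrans PlatStar ψ φstar h x a x' *
          ∑ a', πlat (h + 1) (φ (h + 1) x') a' * f (h + 1) (φ (h + 1) x') a'
        = ∑ s', (∑ x' ∈ Finset.univ.filter (fun x' => φ (h + 1) x' = s'),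
            obsTrans PlatStar ψ φstar h x a x') *
          ∑ a', πlat (h + 1) s' a' * f (h + 1) s' a' := by
      rw [← Finset.sum_fiberwise Finset.univ (φ (h + 1))]
      refine Finset.sum_congr rfl fun s' _ => ?_
      rw [Finset.sum_mul]
      refine Finset.sum_congr rfl fun x' hx' => ?_
      rw [(Finset.mem_filter.mp hx').2]
    rw [hcons h hh, hpush]
    simp only [selfPredErr, ← Finset.mul_sum]
    exact sq_backup_sub_le_hellinger _ _ Rval _ _ _ (hRnn h hh _ _) (hRsum h hh _ _)
      (hRnnStar h hh _ _) (hRsumStar h hh _ _) (hPnn h hh _ _) (hPsum h hh _ _)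
      (fun s' => Finset.sum_nonneg fun x' _ => hTnn h hh x a x')
      ((Finset.sum_fiberwise Finset.univ (φ (h + 1)) _).trans (hTsum x a)) hRval hV
  rw [Finset.mul_sum]
  refine Finset.sum_le_sum fun x _ => ?_
  rw [Finset.mul_sum]
  refine Finset.sum_le_sum fun a _ => ?_
  rw [mul_left_comm]
  refine mul_le_mul_of_nonneg_left (hpointwise x a)
    (mul_nonneg (docc_nonneg _ _ _ h (fun y => ?_) ?_ ?_ x) ((hπ h (by omega) _).1 a))
  · exact mul_nonneg (h00 _) (hψnn 0 (by omega) _ _)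
  · exact fun k hk => hTnn k (hk.trans hh)
  · exact fun k hk y b => (hπ k (by omega) _).1 b
end
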